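/- arXiv:1112.1201 — 4 statements merged into one kernel-verified Lean document; each statement's English description precedes it below -/
import Mathlib

section
/- For every function f : B^N → B^N, the map G_f : X → X defined by G_f(S,E) = (σ(S), F_f(S^1, E)) is continuous on the metric space (X,d). -/
open scoped BigOperators

/-- Sum of the discrete Boolean metric over the `N` coordinates (Hamming-type distance). -/
noncomputable def de (N : ℕ) (E F : Fin N → Bool) : ℝ :=
  ∑ k : Fin N, if E k = F k then (0 : ℝ) else 1

/-- Distance between strategies: `(9/N) Σ_k |S^k − Š^k| / 10^k`. -/
noncomputable def ds (N : ℕ) (S T : ℕ → Fin N) : ℝ :=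
  (9 / N) * ∑' k : ℕ, |((S k : ℕ) : ℝ) - ((T k : ℕ) : ℝ)| / 10 ^ (k + 1)

/-- The distance on the phase space `X = {1,…,N}^ℕ × B^N`. -/
noncomputable def dX (N : ℕ) (x y : (ℕ → Fin N) × (Fin N → Bool)) : ℝ :=
  de N x.2 y.2 + ds N x.1 y.1

/-- `F_f(k,E)` agrees with `E` except in coordinate `k`, where it equals `f(E)_k`. -/
def Ff (N : ℕ) (f : (Fin N → Bool) → (Fin N → Bool)) (k : Fin N) (E : Fin N → Bool) :
    Fin N → Bool :=
  fun j => if j = k then f E k else E j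

/-- `G_f(S,E) = (σ(S), F_f(S^1,E))`, where `σ` is the shift on strategies. -/
def G (N : ℕ) (f : (Fin N → Bool) → (Fin N → Bool))
    (x : (ℕ → Fin N) × (Fin N → Bool)) : (ℕ → Fin N) × (Fin N → Bool) :=
  (fun n => x.1 (n + 1), Ff N f (x.1 0) x.2)

/-- The vectorial negation `f₀`. -/
def f0 (N : ℕ) (E : Fin N → Bool) : Fin N → Bool := fun i => !(E i)

/-- A set is open for the metric `dX`. -/
def dOpen (N : ℕ) (U : Set ((ℕ → Fin N) × (Fin N → Bool))) : Prop :=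
  ∀ x ∈ U, ∃ ε > 0, ∀ y, dX N x y < ε → y ∈ U

/-- A set is closed for the metric `dX`. -/
def dClosed (N : ℕ) (A : Set ((ℕ → Fin N) × (Fin N → Bool))) : Prop :=
  dOpen N Aᶜ

theorem ds_summable {N : ℕ} (S T : ℕ → Fin N) :
    Summable fun k : ℕ => |((S k : ℕ) : ℝ) - ((T k : ℕ) : ℝ)| / 10 ^ (k + 1) := by
  have hgeom : Summable fun k : ℕ => (N : ℝ) * (1 / 10 : ℝ) ^ (k + 1) :=
    ((summable_nat_add_iff 1).2
      (summable_geometric_of_lt_one (by norm_num) (by norm_num))).mul_left _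
  refine hgeom.of_nonneg_of_le (fun k => by positivity) fun k => ?_
  have hS : ((S k : ℕ) : ℝ) ≤ N := by exact_mod_cast (S k).isLt.le
  have hT : ((T k : ℕ) : ℝ) ≤ N := by exact_mod_cast (T k).isLt.le
  rw [one_div_pow, mul_one_div]
  gcongr
  rw [abs_le]
  constructor <;> linarith [(S k : ℕ).cast_nonneg (α := ℝ), (T k : ℕ).cast_nonneg (α := ℝ)]

theorem ds_nonneg {N : ℕ} (S T : ℕ → Fin N) : 0 ≤ ds N S T :=
  mul_nonneg (by positivity) (tsum_nonneg fun _ => by positivity)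

theorem de_nonneg {N : ℕ} (E F : Fin N → Bool) : 0 ≤ de N E F :=
  Finset.sum_nonneg fun _ _ => by split_ifs <;> norm_num

theorem de_self {N : ℕ} (E : Fin N → Bool) : de N E E = 0 := by
  simp [de]

theorem eq_of_de_lt_one {N : ℕ} {E F : Fin N → Bool} (h : de N E F < 1) : E = F := by
  funext k
  by_contra hk
  have hle : (if E k = F k then (0 : ℝ) else 1) ≤ de N E F :=
    Finset.single_le_sum (f := fun k => if E k = F k then (0 : ℝ) else 1)
      (fun _ _ => by split_ifs <;> norm_num) (Finset.mem_univ k)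
  rw [if_neg hk] at hle
  linarith

/-- Splitting off the first term of the series expresses `ds` through the shifted strategies. -/
theorem ds_eq_head_add_shift {N : ℕ} (S T : ℕ → Fin N) :
    ds N S T = (9 / N) * (|((S 0 : ℕ) : ℝ) - ((T 0 : ℕ) : ℝ)| / 10) +
      ds N (fun n => S (n + 1)) (fun n => T (n + 1)) / 10 := by
  have hshift : ∑' k : ℕ, |((S (k + 1) : ℕ) : ℝ) - ((T (k + 1) : ℕ) : ℝ)| / 10 ^ (k + 1 + 1) =
      (∑' k : ℕ, |((S (k + 1) : ℕ) : ℝ) - ((T (k + 1) : ℕ) : ℝ)| / 10 ^ (k + 1)) / 10 := by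
    rw [← tsum_div_const]
    refine tsum_congr fun k => ?_
    rw [pow_succ _ (k + 1), div_mul_eq_div_div]
  rw [ds, ds, (ds_summable S T).tsum_eq_zero_add, hshift]
  ring

theorem ds_shift_le {N : ℕ} (S T : ℕ → Fin N) :
    ds N (fun n => S (n + 1)) (fun n => T (n + 1)) ≤ 10 * ds N S T := by
  have hhead : 0 ≤ (9 / N : ℝ) * (|((S 0 : ℕ) : ℝ) - ((T 0 : ℕ) : ℝ)| / 10) := by positivity
  linarith [ds_eq_head_add_shift S T]

theorem head_eq_of_ds_lt {N : ℕ} {S T : ℕ → Fin N} (h : ds N S T < 9 / N / 10) :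
    S 0 = T 0 := by
  by_contra hne
  have hint : (1 : ℤ) ≤ |((S 0 : ℕ) : ℤ) - ((T 0 : ℕ) : ℤ)| :=
    Int.one_le_abs fun h0 => hne (Fin.ext (by omega))
  have habs : (1 : ℝ) ≤ |((S 0 : ℕ) : ℝ) - ((T 0 : ℕ) : ℝ)| := by exact_mod_cast hint
  have hhead : (9 / N : ℝ) * (1 / 10) ≤
      (9 / N : ℝ) * (|((S 0 : ℕ) : ℝ) - ((T 0 : ℕ) : ℝ)| / 10) := by gcongr
  linarith [ds_eq_head_add_shift S T,
    ds_nonneg (fun n => S (n + 1)) (fun n => T (n + 1))]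

/-- For every `f : B^N → B^N`, the map `G_f` is continuous on the metric space `(X,d)`. -/
theorem Gf_continuous (N : ℕ) (hN : 2 ≤ N)
    (f : (Fin N → Bool) → (Fin N → Bool)) :
    ∀ x : (ℕ → Fin N) × (Fin N → Bool), ∀ ε > (0 : ℝ), ∃ δ > (0 : ℝ),
      ∀ y : (ℕ → Fin N) × (Fin N → Bool),
        dX N x y < δ → dX N (G N f x) (G N f y) < ε := by
  intro x ε hε
  have hN' : (2 : ℝ) ≤ N := by exact_mod_cast hN
  have hpos : (0 : ℝ) < 9 / N / 10 := by positivity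
  have hlt : (9 / N / 10 : ℝ) < 1 := by
    rw [div_div, div_lt_one (by positivity)]
    linarith
  refine ⟨min (9 / N / 10) (ε / 10), lt_min hpos (by positivity), fun y hxy => ?_⟩
  obtain ⟨hδ, hδε⟩ := lt_min_iff.1 hxy
  rw [dX] at hδ hδε
  have hde := de_nonneg x.2 y.2
  have hds := ds_nonneg x.1 y.1
  have hE : x.2 = y.2 := eq_of_de_lt_one (by linarith)
  have hS : x.1 0 = y.1 0 := head_eq_of_ds_lt (by linarith)
  simp only [dX, G, hE, hS, de_self, zero_add]
  linarith [ds_shift_le x.1 y.1]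
end

section
/- The set of periodic points of G_{f₀} is dense in (X,d): for every point x ∈ X and every ε > 0 there exist p ∈ X and n ∈ ℕ* with G_{f₀}^n(p) = p and d(x,p) < ε. -/
open scoped BigOperators

/-- Along a fixed strategy, iterating `G` on the vectorial negation shifts the strategy and
adds a fixed Boolean vector modulo two. -/
theorem exists_iterate_G_f0_eq_xor (N n : ℕ) (S : ℕ → Fin N) :
    ∃ c : Fin N → Bool, ∀ E : Fin N → Bool,
      (G N (f0 N))^[n] (S, E) = (fun k => S (k + n), fun j => xor (E j) (c j)) := by
  induction n generalizing S with
  | zero => exact ⟨fun _ => false, fun E => by simp⟩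
  | succ n ih =>
    obtain ⟨c, hc⟩ := ih fun k => S (k + 1)
    refine ⟨fun j => xor (decide (j = S 0)) (c j), fun E => ?_⟩
    rw [Function.iterate_succ_apply, G, hc]
    refine Prod.ext (funext fun k => ?_) (funext fun j => ?_)
    · simp only [add_assoc]
    · by_cases h : j = S 0 <;> simp [Ff, f0, h]

/-- A point whose strategy has period `m` returns to itself after `2 * m` iterations. -/
theorem iterate_G_f0_two_mul_of_periodic {N m : ℕ} {S : ℕ → Fin N} (hS : Function.Periodic S m)
    (E : Fin N → Bool) : (G N (f0 N))^[2 * m] (S, E) = (S, E) := by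
  obtain ⟨c, hc⟩ := exists_iterate_G_f0_eq_xor N m S
  have hS' : (fun k => S (k + m)) = S := funext hS
  rw [two_mul, Function.iterate_add_apply, hc, hS', hc, hS']
  simp

/-- Strategies that agree on their first `m` terms are close. -/
theorem ds_le_of_eqOn_lt {N m : ℕ} (hN : 0 < N) {S T : ℕ → Fin N} (h : ∀ k < m, S k = T k) :
    ds N S T ≤ 9 / 5 ^ m := by
  have hterm (k : ℕ) : |((S k : ℕ) : ℝ) - ((T k : ℕ) : ℝ)| / 10 ^ (k + 1)
      ≤ (N : ℝ) / 5 ^ m / 2 / 2 ^ k := by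
    rcases lt_or_ge k m with hk | hk
    · rw [h k hk, sub_self, abs_zero, zero_div]
      positivity
    · have hS : ((S k : ℕ) : ℝ) ≤ N := by exact_mod_cast (S k).isLt.le
      have hT : ((T k : ℕ) : ℝ) ≤ N := by exact_mod_cast (T k).isLt.le
      have habs : |((S k : ℕ) : ℝ) - ((T k : ℕ) : ℝ)| ≤ N :=
        abs_sub_le_of_nonneg_of_le (Nat.cast_nonneg _) hS (Nat.cast_nonneg _) hT
      have hpow : (5 : ℝ) ^ m * 2 * 2 ^ k ≤ 10 ^ (k + 1) := by
        have h5 : (5 : ℝ) ^ m ≤ 5 ^ (k + 1) :=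
          pow_le_pow_right₀ (by norm_num) (by omega)
        calc (5 : ℝ) ^ m * 2 * 2 ^ k = 5 ^ m * 2 ^ (k + 1) := by ring
          _ ≤ 5 ^ (k + 1) * 2 ^ (k + 1) := by gcongr
          _ = 10 ^ (k + 1) := by rw [← mul_pow]; norm_num
      rw [div_div, div_div, ← mul_assoc]
      gcongr
  have hsum : Summable fun k : ℕ => (N : ℝ) / 5 ^ m / 2 / 2 ^ k := summable_geometric_two' _
  have htsum : ∑' k : ℕ, |((S k : ℕ) : ℝ) - ((T k : ℕ) : ℝ)| / 10 ^ (k + 1) ≤ (N : ℝ) / 5 ^ m :=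
    (Summable.tsum_le_tsum hterm
      (Summable.of_nonneg_of_le (fun k => by positivity) hterm hsum) hsum).trans_eq
      (tsum_geometric_two' _)
  have hN' : (N : ℝ) ≠ 0 := by exact_mod_cast hN.ne'
  calc ds N S T ≤ 9 / N * (N / 5 ^ m) := by unfold ds; gcongr
    _ = 9 / 5 ^ m := by field_simp

/-- The periodic points of `G_{f₀}` are dense in `(X,d)`. -/
theorem Gf0_dense_periodic_points (N : ℕ) (hN : 2 ≤ N) :
    ∀ x : (ℕ → Fin N) × (Fin N → Bool), ∀ ε > (0 : ℝ),
      ∃ p : (ℕ → Fin N) × (Fin N → Bool), ∃ n : ℕ, 0 < n ∧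
        (G N (f0 N))^[n] p = p ∧ dX N x p < ε := by
  rintro ⟨S, E⟩ ε hε
  obtain ⟨m, hm⟩ := exists_pow_lt_of_lt_one (show 0 < ε / 9 by positivity)
    (show (1 / 5 : ℝ) < 1 by norm_num)
  have hper : Function.Periodic (fun k => S (k % (m + 1))) (m + 1) := fun k => by simp
  refine ⟨(fun k => S (k % (m + 1)), E), 2 * (m + 1), by omega,
    iterate_G_f0_two_mul_of_periodic hper E, ?_⟩
  have hds : ds N S (fun k => S (k % (m + 1))) ≤ 9 / 5 ^ m :=
    ds_le_of_eqOn_lt (by omega) fun k hk => by rw [Nat.mod_eq_of_lt (by omega)]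
  have hde : de N E E = 0 := by simp [de]
  calc dX N (S, E) (fun k => S (k % (m + 1)), E)
      = ds N S (fun k => S (k % (m + 1))) := by simp [dX, hde]
    _ ≤ 9 / 5 ^ m := hds
    _ = 9 * (1 / 5) ^ m := by rw [one_div, inv_pow, div_eq_mul_inv]
    _ < ε := by linarith
end

section
/- G_{f₀} is strongly transitive on (X,d): for all x, y ∈ X and every r > 0 there exist z ∈ X with d(z,x) ≤ r and n ∈ ℕ* such that G_{f₀}^n(z) = y. -/
open scoped BigOperators

/-- Two strategies that agree on their first `m` terms are at distance at most `18 / 2 ^ m`. -/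
theorem ds_le_of_agree {N : ℕ} {S T : ℕ → Fin N} {m : ℕ}
    (h : ∀ k < m, S k = T k) : ds N S T ≤ 18 * (1 / 2) ^ m := by
  have hN : (0 : ℝ) < N := by exact_mod_cast (S 0).pos
  have hterm : ∀ k, |((S k : ℕ) : ℝ) - ((T k : ℕ) : ℝ)| / 10 ^ (k + 1) ≤
      N * (1 / 2) ^ m * (1 / 2) ^ k := by
    intro k
    rcases lt_or_ge k m with hk | hk
    · rw [h k hk, sub_self, abs_zero, zero_div]
      positivity
    · have hS : ((S k : ℕ) : ℝ) ≤ N := by exact_mod_cast (S k).isLt.le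
      have hT : ((T k : ℕ) : ℝ) ≤ N := by exact_mod_cast (T k).isLt.le
      have habs : |((S k : ℕ) : ℝ) - ((T k : ℕ) : ℝ)| ≤ N :=
        abs_sub_le_of_nonneg_of_le (Nat.cast_nonneg _) hS (Nat.cast_nonneg _) hT
      have hpow : (1 / 10 : ℝ) ^ (k + 1) ≤ (1 / 2) ^ m * (1 / 2) ^ k := calc
        (1 / 10 : ℝ) ^ (k + 1) ≤ (1 / 10) ^ k :=
          pow_le_pow_of_le_one (by norm_num) (by norm_num) k.le_succ
        _ ≤ (1 / 4) ^ k := by gcongr; norm_num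
        _ = (1 / 2) ^ k * (1 / 2) ^ k := by rw [← mul_pow]; norm_num
        _ ≤ (1 / 2) ^ m * (1 / 2) ^ k := by
          gcongr ?_ * _
          exact pow_le_pow_of_le_one (by norm_num) (by norm_num) hk
      calc |((S k : ℕ) : ℝ) - ((T k : ℕ) : ℝ)| / 10 ^ (k + 1)
          = |((S k : ℕ) : ℝ) - ((T k : ℕ) : ℝ)| * (1 / 10) ^ (k + 1) := by
            rw [one_div_pow, mul_one_div]
        _ ≤ N * ((1 / 2) ^ m * (1 / 2) ^ k) := by gcongr
        _ = N * (1 / 2) ^ m * (1 / 2) ^ k := by ring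
  have hsum : HasSum (fun k : ℕ => (N : ℝ) * (1 / 2) ^ m * (1 / 2) ^ k)
      (N * (1 / 2) ^ m * 2) := hasSum_geometric_two.mul_left _
  have htsum : ∑' k : ℕ, |((S k : ℕ) : ℝ) - ((T k : ℕ) : ℝ)| / 10 ^ (k + 1) ≤
      N * (1 / 2) ^ m * 2 :=
    (Summable.tsum_le_tsum hterm
      (hsum.summable.of_nonneg_of_le (fun k => by positivity) hterm)
      hsum.summable).trans_eq hsum.tsum_eq
  calc ds N S T ≤ 9 / N * (N * (1 / 2) ^ m * 2) := by unfold ds; gcongr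
    _ = 18 * (1 / 2) ^ m := by field_simp; norm_num

/-- Prepending `a` to a strategy and applying `G` updates the coordinate `a`. -/
theorem G_cons {N : ℕ} (f : (Fin N → Bool) → (Fin N → Bool)) (a : Fin N) (S : ℕ → Fin N)
    (E : Fin N → Bool) :
    G N f (fun k => Nat.casesOn k a S, E) = (S, Ff N f a E) := rfl

/-- If `E` and `F` agree outside `s`, some strategy leads from `E` to `(T, F)`. -/
theorem exists_iterate_G_f0_eq {N : ℕ} (T : ℕ → Fin N) (F : Fin N → Bool) (s : Finset (Fin N)) :
    ∀ E : Fin N → Bool, (∀ j ∉ s, E j = F j) →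
      ∃ S : ℕ → Fin N, ∃ n : ℕ, (G N (f0 N))^[n] (S, E) = (T, F) := by
  induction s using Finset.induction_on with
  | empty =>
    intro E hE
    obtain rfl : E = F := funext fun j => hE j (Finset.notMem_empty j)
    exact ⟨T, 0, rfl⟩
  | insert a s _ ih =>
    intro E hE
    by_cases ha : E a = F a
    · refine ih E fun j hj => ?_
      by_cases hja : j = a
      · rw [hja, ha]
      · exact hE j (by simp [hja, hj])
    · obtain ⟨S, n, hn⟩ := ih (Ff N (f0 N) a E) fun j hj => by
        by_cases hja : j = a
        · subst hja
          simpa [Ff, f0, Bool.eq_not] using ha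
        · simpa [Ff, hja] using hE j (by simp [hja, hj])
      exact ⟨fun k => Nat.casesOn k a S, n + 1, by rw [Function.iterate_succ_apply, G_cons, hn]⟩

/-- Any point is reached from `E` by a strategy with prescribed first `m` terms. -/
theorem exists_agree_iterate_G_f0_eq {N : ℕ} (y : (ℕ → Fin N) × (Fin N → Bool)) (m : ℕ) :
    ∀ (S : ℕ → Fin N) (E : Fin N → Bool), ∃ S' : ℕ → Fin N, (∀ k < m, S' k = S k) ∧
      ∃ n : ℕ, m ≤ n ∧ (G N (f0 N))^[n] (S', E) = y := by
  induction m with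
  | zero =>
    intro S E
    obtain ⟨S', n, hn⟩ := exists_iterate_G_f0_eq y.1 y.2 Finset.univ E (by simp)
    exact ⟨S', by simp, n, n.zero_le, hn⟩
  | succ m ih =>
    intro S E
    obtain ⟨S', hS', n, hmn, hn⟩ := ih (fun k => S (k + 1)) (Ff N (f0 N) (S 0) E)
    refine ⟨fun k => Nat.casesOn k (S 0) S', ?_, n + 1, Nat.succ_le_succ hmn, ?_⟩
    · rintro (_ | k) hk
      · rfl
      · exact hS' k (Nat.lt_of_succ_lt_succ hk)
    · rw [Function.iterate_succ_apply, G_cons, hn]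

/-- `G_{f₀}` is strongly transitive on `(X,d)`. -/
theorem Gf0_strongly_transitive (N : ℕ) (hN : 2 ≤ N) :
    ∀ x y : (ℕ → Fin N) × (Fin N → Bool), ∀ r > (0 : ℝ),
      ∃ z : (ℕ → Fin N) × (Fin N → Bool), dX N z x ≤ r ∧
        ∃ n : ℕ, 0 < n ∧ (G N (f0 N))^[n] z = y := by
  intro x y r hr
  obtain ⟨m, hm⟩ := exists_pow_lt_of_lt_one (show 0 < r / 18 by positivity)
    (show (1 / 2 : ℝ) < 1 by norm_num)
  obtain ⟨S, hS, n, hmn, hn⟩ := exists_agree_iterate_G_f0_eq y (m + 1) x.1 x.2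
  refine ⟨(S, x.2), ?_, n, by omega, hn⟩
  have hds : ds N S x.1 ≤ 18 * (1 / 2) ^ m :=
    ds_le_of_agree fun k hk => hS k (hk.trans m.lt_succ_self)
  have hde : de N x.2 x.2 = 0 := by simp [de]
  change de N x.2 x.2 + ds N S x.1 ≤ r
  linarith
end

section
/- For the XORshift transformation T on 32-bit words defined by T(z) = z₂ XOR (z₂ << 5) with z₂ = z₁ XOR (z₁ >> 17) and z₁ = z XOR (z << 13), and for every nonzero 32-bit word z, the least positive integer n with T^n(z) = z is 2³² − 1; that is, the generator has period 2³² − 1 on every nonzero seed. -/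
/-- One round of the XORshift transformation on 32-bit words:
`z₁ = z XOR (z << 13)`, `z₂ = z₁ XOR (z₁ >> 17)`, `T(z) = z₂ XOR (z₂ << 5)`. -/
def xorshiftT (z : BitVec 32) : BitVec 32 :=
  let z1 := z ^^^ (z <<< 13)
  let z2 := z1 ^^^ (z1 >>> 17)
  z2 ^^^ (z2 <<< 5)

open Function

/-- The XOR of those entries of the list that are selected by the binary digits of `n`, least
significant digit first: the linear map over `𝔽₂` whose matrix has the given columns. -/
def xorCombination : List ℕ → ℕ → ℕ
  | [], _ => 0
  | c :: cs, n => n % 2 * c ^^^ xorCombination cs (n / 2)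

/-- The columns `f 1, f 2, f 4, …, f (2 ^ (k - 1))` of the matrix of `f`. -/
def xorColumns (f : ℕ → ℕ) : ℕ → List ℕ
  | 0 => []
  | k + 1 => f 1 :: xorColumns (fun n => f (2 * n)) k

/-- Apply the `n`-th power of the matrix with columns `c` to `v` by repeated squaring, reading `k`
binary digits of `n`. -/
def xorPowApply : ℕ → List ℕ → ℕ → ℕ → ℕ
  | 0, _, _, v => v
  | k + 1, c, n, v =>
    xorPowApply k (c.map (xorCombination c)) (n / 2) (if n % 2 = 1 then xorCombination c v else v)

theorem xorCombination_zero (c : List ℕ) : xorCombination c 0 = 0 := by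
  induction c with
  | nil => rfl
  | cons a c ih => simp [xorCombination, ih]

theorem xorCombination_xor (c : List ℕ) (m n : ℕ) :
    xorCombination c (m ^^^ n) = xorCombination c m ^^^ xorCombination c n := by
  induction c generalizing m n with
  | nil => simp [xorCombination]
  | cons a c ih =>
    have h : (m ^^^ n) % 2 * a = m % 2 * a ^^^ n % 2 * a := by
      have := @Nat.xor_mod_two_eq_one m n
      rcases Nat.mod_two_eq_zero_or_one m with hm | hm <;>
      rcases Nat.mod_two_eq_zero_or_one n with hn | hn <;>
      rcases Nat.mod_two_eq_zero_or_one (m ^^^ n) with hmn | hmn <;>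
      simp_all
    simp only [xorCombination, h, Nat.xor_div_two, ih]
    ac_rfl

theorem xorCombination_map (c d : List ℕ) (n : ℕ) :
    xorCombination (d.map (xorCombination c)) n = xorCombination c (xorCombination d n) := by
  induction d generalizing n with
  | nil => simp [xorCombination, xorCombination_zero]
  | cons a d ih =>
    rcases Nat.mod_two_eq_zero_or_one n with hn | hn <;>
    simp [xorCombination, xorCombination_xor, ih, hn]

theorem xorPowApply_eq (k : ℕ) (c : List ℕ) (n v : ℕ) (hn : n < 2 ^ k) :
    xorPowApply k c n v = (xorCombination c)^[n] v := by
  induction k generalizing c n v with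
  | zero =>
    obtain rfl : n = 0 := by simpa using hn
    rfl
  | succ k ih =>
    have hsq : xorCombination (c.map (xorCombination c)) = (xorCombination c)^[2] :=
      funext (xorCombination_map c c)
    rw [xorPowApply, ih _ _ _ (by omega), hsq, ← iterate_mul]
    split_ifs with h
    · rw [← iterate_succ_apply, show (2 * (n / 2)).succ = n by omega]
    · rw [show 2 * (n / 2) = n by omega]

theorem xorCombination_xorColumns (k : ℕ) (f : ℕ → ℕ)
    (hf : ∀ m n, f (m ^^^ n) = f m ^^^ f n) (n : ℕ) (hn : n < 2 ^ k) :
    xorCombination (xorColumns f k) n = f n := by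
  have hf0 : f 0 = 0 := by simpa using hf 0 0
  induction k generalizing f n with
  | zero =>
    obtain rfl : n = 0 := by simpa using hn
    exact hf0.symm
  | succ k ih =>
    have h2 (m n : ℕ) : 2 * (m ^^^ n) = 2 * m ^^^ 2 * n := by
      simpa [Nat.shiftLeft_eq, mul_comm] using Nat.shiftLeft_xor_distrib (a := m) (b := n) (i := 1)
    rw [xorColumns, xorCombination,
      ih (fun n => f (2 * n)) (fun m n => by simp only [h2, hf]) _ (by omega) hf0]
    rcases Nat.mod_two_eq_zero_or_one n with h | h
    · simp [h, show 2 * (n / 2) = n by omega]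
    · have : 1 ^^^ 2 * (n / 2) = n := by
        apply Nat.eq_of_testBit_eq
        intro i
        cases i with
        | zero => simp [h]
        | succ i => simp [Nat.testBit_succ, Nat.xor_div_two]
      rw [h, one_mul, ← hf, this]

theorem Function.minimalPeriod_eq_of_forall_prime {α : Type*} {f : α → α} {x : α} {n : ℕ}
    (hx : IsPeriodicPt f n x)
    (hp : ∀ p : ℕ, p.Prime → p ∣ n → ¬IsPeriodicPt f (n / p) x) : minimalPeriod f x = n := by
  obtain ⟨a, ha⟩ := hx.minimalPeriod_dvd
  by_contra h
  have ha1 : a ≠ 1 := by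
    rintro rfl
    exact h (by simpa using ha.symm)
  obtain ⟨b, hb⟩ := a.minFac_dvd
  have hnb : n = a.minFac * (minimalPeriod f x * b) := by
    rw [ha]
    nth_rw 1 [hb]
    ring
  refine hp a.minFac (Nat.minFac_prime ha1) ⟨_, hnb⟩ ?_
  rw [isPeriodicPt_iff_minimalPeriod_dvd]
  exact ⟨b, Nat.div_eq_of_eq_mul_right a.minFac_pos hnb⟩

theorem xorshiftT_xor (x y : BitVec 32) :
    xorshiftT (x ^^^ y) = xorshiftT x ^^^ xorshiftT y := by
  have hl (k : ℕ) (a b : BitVec 32) :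
      (a ^^^ b) ^^^ (a ^^^ b) <<< k = (a ^^^ a <<< k) ^^^ (b ^^^ b <<< k) := by
    rw [BitVec.shiftLeft_xor_distrib]
    ac_rfl
  have hr (k : ℕ) (a b : BitVec 32) :
      (a ^^^ b) ^^^ (a ^^^ b) >>> k = (a ^^^ a >>> k) ^^^ (b ^^^ b >>> k) := by
    rw [BitVec.ushiftRight_xor_distrib]
    ac_rfl
  simp only [xorshiftT]
  rw [hl 13 x y, hr 17 (x ^^^ x <<< 13) (y ^^^ y <<< 13), hl 5]

/-- The columns of the matrix of `xorshiftT`. -/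
def xorshiftColumns : List ℕ :=
  xorColumns (fun n => (xorshiftT (BitVec.ofNat 32 n)).toNat) 32

theorem toNat_xorshiftT (z : BitVec 32) :
    (xorshiftT z).toNat = xorCombination xorshiftColumns z.toNat := by
  rw [xorshiftColumns, xorCombination_xorColumns _ _ _ _ z.isLt]
  · rw [BitVec.ofNat_toNat, BitVec.setWidth_eq]
  · intro m n
    rw [← BitVec.toNat_xor, ← xorshiftT_xor, ← BitVec.ofNat_xor]

theorem toNat_xorshiftT_iterate (n : ℕ) (hn : n < 2 ^ 32) (z : BitVec 32) :
    (xorshiftT^[n] z).toNat = xorPowApply 32 xorshiftColumns n z.toNat := by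
  rw [xorPowApply_eq _ _ _ _ hn]
  exact (show Semiconj BitVec.toNat xorshiftT (xorCombination xorshiftColumns) from
    toNat_xorshiftT).iterate_right n z

theorem isPeriodicPt_xorshiftT_iff (n : ℕ) (hn : n < 2 ^ 32) :
    IsPeriodicPt xorshiftT n 1 ↔ xorPowApply 32 xorshiftColumns n 1 = 1 := by
  rw [IsPeriodicPt, IsFixedPt, ← BitVec.toNat_inj, toNat_xorshiftT_iterate n hn]
  rfl

theorem minimalPeriod_xorshiftT_one : minimalPeriod xorshiftT 1 = 2 ^ 32 - 1 := by
  refine minimalPeriod_eq_of_forall_prime ?_ fun p hp hpd => ?_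
  · rw [isPeriodicPt_xorshiftT_iff _ (by norm_num)]
    decide +kernel
  · have hfac : 2 ^ 32 - 1 = 3 * 5 * 17 * 257 * 65537 := by norm_num
    have hmem : p = 3 ∨ p = 5 ∨ p = 17 ∨ p = 257 ∨ p = 65537 := by
      rw [hfac] at hpd
      simpa only [hp.dvd_mul, Nat.prime_dvd_prime_iff_eq hp, Nat.prime_three, Nat.prime_five,
        show Nat.Prime 17 by norm_num, show Nat.Prime 257 by norm_num,
        show Nat.Prime 65537 by norm_num, or_assoc] using hpd
    rw [isPeriodicPt_xorshiftT_iff _ ((Nat.div_le_self _ _).trans_lt (by norm_num))]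
    rcases hmem with rfl | rfl | rfl | rfl | rfl <;> decide +kernel

theorem xorshiftT_iterate_one_ne_zero (n : ℕ) : xorshiftT^[n] 1 ≠ 0 := by
  intro h
  have hfix : IsFixedPt xorshiftT 0 := by decide
  have hpt : IsPeriodicPt xorshiftT (2 ^ 32 - 1) 1 :=
    minimalPeriod_xorshiftT_one ▸ isPeriodicPt_minimalPeriod _ _
  have h1 : xorshiftT^[(2 ^ 32 - 1) * n] 1 = 1 := hpt.mul_const n
  rw [show (2 ^ 32 - 1) * n = (2 ^ 32 - 2) * n + n by omega, iterate_add_apply, h,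
    (hfix.iterate _).eq] at h1
  exact absurd h1 (by decide)

theorem exists_xorshiftT_iterate_one_eq (z : BitVec 32) (hz : z ≠ 0) :
    ∃ n, xorshiftT^[n] 1 = z := by
  have hinj : Set.InjOn (fun n => (xorshiftT^[n] 1).toNat) (Finset.range (2 ^ 32 - 1)) := by
    have h := iterate_injOn_Iio_minimalPeriod (f := xorshiftT) (x := 1)
    rw [minimalPeriod_xorshiftT_one, ← Finset.coe_range] at h
    exact fun m hm n hn hmn => h hm hn (BitVec.eq_of_toNat_eq hmn)
  have himage : (Finset.range (2 ^ 32 - 1)).image (fun n => (xorshiftT^[n] 1).toNat) =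
      Finset.Ico 1 (2 ^ 32) := by
    refine Finset.eq_of_subset_of_card_le (fun m hm => ?_) ?_
    · obtain ⟨n, -, rfl⟩ := Finset.mem_image.1 hm
      refine Finset.mem_Ico.2 ⟨Nat.one_le_iff_ne_zero.2 fun h => ?_, BitVec.isLt _⟩
      exact xorshiftT_iterate_one_ne_zero n (BitVec.eq_of_toNat_eq h)
    · rw [Finset.card_image_of_injOn hinj, Finset.card_range, Nat.card_Ico]
  have hmem : z.toNat ∈ Finset.Ico 1 (2 ^ 32) :=
    Finset.mem_Ico.2 ⟨Nat.one_le_iff_ne_zero.2 fun h => hz (BitVec.eq_of_toNat_eq h), z.isLt⟩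
  rw [← himage] at hmem
  obtain ⟨n, -, hn⟩ := Finset.mem_image.1 hmem
  exact ⟨n, BitVec.eq_of_toNat_eq hn⟩

/-- For every nonzero 32-bit seed, the least positive `n` with `T^n(z) = z` is
`2³² − 1`: the XORshift generator has period `2³² − 1` on every nonzero seed. -/
theorem xorshiftT_period (z : BitVec 32) (hz : z ≠ 0) :
    IsLeast {n : ℕ | 0 < n ∧ xorshiftT^[n] z = z} (2 ^ 32 - 1) := by
  obtain ⟨m, rfl⟩ := exists_xorshiftT_iterate_one_eq z hz
  have hone : (1 : BitVec 32) ∈ periodicPts xorshiftT := by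
    rw [← minimalPeriod_pos_iff_mem_periodicPts, minimalPeriod_xorshiftT_one]
    norm_num
  have hper : minimalPeriod xorshiftT (xorshiftT^[m] 1) = 2 ^ 32 - 1 := by
    rw [minimalPeriod_apply_iterate hone, minimalPeriod_xorshiftT_one]
  refine ⟨⟨by norm_num, ?_⟩, fun n hn => ?_⟩
  · rw [← hper]
    exact iterate_minimalPeriod
  · rw [← hper]
    exact IsPeriodicPt.minimalPeriod_le hn.1 hn.2
end
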